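/- For all i ∈ ℤ/nℤ the intertwining identities ρ_{n+1}(e_i) ∘ ι = ι ∘ ρ_n(E_i), ρ_{n+1}(f_i) ∘ ι = ι ∘ ρ_n(F_i), and ρ_{n+1}(k_i^{±1}) ∘ ι = ι ∘ ρ_n(K_i^{±1}) hold; in particular the image W_n of ι (the span of the ŭ_m with m not congruent to r+1 modulo n+1) is invariant under ρ_{n+1}(x) for every x in the subalgebra of U(ŝl_{n+1}) generated by the elements e_i, f_i, k_i^{±1} (i ∈ ℤ/nℤ). -/

import Mathlib

noncomputable section

/-- The field ℚ(v) of rational functions over ℚ. -/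
abbrev Qv : Type := RatFunc ℚ

/-- The indeterminate v. -/
def vv : Qv := RatFunc.X

/-- The quantum integer [a] = (v^a - v^{-a})/(v - v⁻¹). -/
def qint (a : ℕ) : Qv := (vv ^ (a : ℤ) - vv ^ (-(a : ℤ))) / (vv - vv⁻¹)

/-- The quantum factorial [a]! = [a][a-1]⋯[1]. -/
def qfact : ℕ → Qv
  | 0 => 1
  | n + 1 => qint (n + 1) * qfact n

/-- Divided power x^{(p)} = x^p / [p]!. -/
def dp {A : Type} [Ring A] [Algebra Qv A] (x : A) (p : ℕ) : A :=
  (qfact p)⁻¹ • x ^ p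

/-- The affine type A Cartan matrix entries c_{ij} = 2δ_{i,j} - δ_{i,j+1} - δ_{i,j-1}. -/
def cartan {m : ℕ} (i j : ZMod m) : ℤ :=
  (if i = j then 2 else 0) - (if i = j + 1 then 1 else 0) - (if i = j - 1 then 1 else 0)

/-- Generators of the quantum affine algebra U(ŝl_m). -/
inductive Gen (m : ℕ) : Type
  | E : ZMod m → Gen m
  | F : ZMod m → Gen m
  | K : ZMod m → Gen m
  | Kinv : ZMod m → Gen m

abbrev FA (m : ℕ) := FreeAlgebra Qv (Gen m)

def fE {m : ℕ} (i : ZMod m) : FA m := FreeAlgebra.ι Qv (Gen.E i)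
def fF {m : ℕ} (i : ZMod m) : FA m := FreeAlgebra.ι Qv (Gen.F i)
def fK {m : ℕ} (i : ZMod m) : FA m := FreeAlgebra.ι Qv (Gen.K i)
def fKinv {m : ℕ} (i : ZMod m) : FA m := FreeAlgebra.ι Qv (Gen.Kinv i)

/-- The defining relations of the quantum affine algebra U(ŝl_m). -/
inductive URel (m : ℕ) : FA m → FA m → Prop
  | KK : ∀ i j, URel m (fK i * fK j) (fK j * fK i)
  | KKinv : ∀ i, URel m (fK i * fKinv i) 1
  | KinvK : ∀ i, URel m (fKinv i * fK i) 1
  | KE : ∀ i j, URel m (fK i * fE j) (vv ^ cartan i j • (fE j * fK i))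
  | KF : ∀ i j, URel m (fK i * fF j) (vv ^ (-cartan i j) • (fF j * fK i))
  | EF : ∀ i j, URel m (fE i * fF j - fF j * fE i)
      (if i = j then (vv - vv⁻¹)⁻¹ • (fK i - fKinv i) else 0)
  | serreE : ∀ i j, i ≠ j →
      URel m (∑ p ∈ Finset.range ((1 - cartan i j).toNat + 1),
        ((-1 : Qv) ^ p) • (dp (fE i) p * fE j * dp (fE i) ((1 - cartan i j).toNat - p))) 0
  | serreF : ∀ i j, i ≠ j →
      URel m (∑ p ∈ Finset.range ((1 - cartan i j).toNat + 1),
        ((-1 : Qv) ^ p) • (dp (fF i) p * fF j * dp (fF i) ((1 - cartan i j).toNat - p))) 0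

/-- The quantum affine algebra U(ŝl_m), presented by generators and relations. -/
abbrev U (m : ℕ) := RingQuot (URel m)

def UE {m : ℕ} (i : ZMod m) : U m := RingQuot.mkAlgHom Qv (URel m) (fE i)
def UF {m : ℕ} (i : ZMod m) : U m := RingQuot.mkAlgHom Qv (URel m) (fF i)
def UK {m : ℕ} (i : ZMod m) : U m := RingQuot.mkAlgHom Qv (URel m) (fK i)
def UKinv {m : ℕ} (i : ZMod m) : U m := RingQuot.mkAlgHom Qv (URel m) (fKinv i)

/-- The element e_r = Ĕ_r Ĕ_{r+1} − v^ε Ĕ_{r+1} Ĕ_r in U(ŝl_{n+1}). -/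
def er (n r : ℕ) (ε : ℤ) : U (n + 1) :=
  UE (r : ZMod (n + 1)) * UE ((r : ZMod (n + 1)) + 1) -
    vv ^ ε • (UE ((r : ZMod (n + 1)) + 1) * UE (r : ZMod (n + 1)))

/-- The element f_r = F̆_{r+1} F̆_r − v^{−ε} F̆_r F̆_{r+1} in U(ŝl_{n+1}). -/
def fr (n r : ℕ) (ε : ℤ) : U (n + 1) :=
  UF ((r : ZMod (n + 1)) + 1) * UF (r : ZMod (n + 1)) -
    vv ^ (-ε) • (UF (r : ZMod (n + 1)) * UF ((r : ZMod (n + 1)) + 1))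

/-- The element k_r = K̆_r K̆_{r+1} in U(ŝl_{n+1}). -/
def kr (n r : ℕ) : U (n + 1) :=
  UK (r : ZMod (n + 1)) * UK ((r : ZMod (n + 1)) + 1)

/-- The image e_i ∈ U(ŝl_{n+1}) of the generator E_i, i ∈ ℤ/nℤ. -/
def eElt (n r : ℕ) (ε : ℤ) (i : ZMod n) : U (n + 1) :=
  if i.val < r then UE ((i.val : ZMod (n + 1)))
  else if i.val = r then er n r ε
  else UE ((i.val + 1 : ℕ) : ZMod (n + 1))

def fElt (n r : ℕ) (ε : ℤ) (i : ZMod n) : U (n + 1) :=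
  if i.val < r then UF ((i.val : ZMod (n + 1)))
  else if i.val = r then fr n r ε
  else UF ((i.val + 1 : ℕ) : ZMod (n + 1))

def kElt (n r : ℕ) (i : ZMod n) : U (n + 1) :=
  if i.val < r then UK ((i.val : ZMod (n + 1)))
  else if i.val = r then kr n r
  else UK ((i.val + 1 : ℕ) : ZMod (n + 1))

def kinvElt (n r : ℕ) (i : ZMod n) : U (n + 1) :=
  if i.val < r then UKinv ((i.val : ZMod (n + 1)))
  else if i.val = r then UKinv (r : ZMod (n + 1)) * UKinv ((r : ZMod (n + 1)) + 1)
  else UKinv ((i.val + 1 : ℕ) : ZMod (n + 1))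


/-- The natural representation space: the ℚ(v)-vector space with basis {u_k : k ∈ ℤ}. -/
abbrev Vmod : Type := ℤ →₀ Qv

/-- The basis vector u_k (also written ŭ_k for V_{n+1}). -/
def uu (k : ℤ) : Vmod := Finsupp.single k 1

section NaturalRepresentation

variable {m : ℕ}

/-- `ρ` is the natural representation of `U(ŝl_m)` on the space with basis `u_k`. -/
def IsNaturalRep (ρ : U m →ₐ[Qv] Module.End Qv Vmod) : Prop :=
  ∀ (i : ZMod m) (k : ℤ),
    ρ (UE i) (uu k) = (if ((k : ZMod m)) = i + 1 then uu (k - 1) else 0) ∧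
    ρ (UF i) (uu k) = (if ((k : ZMod m)) = i then uu (k + 1) else 0) ∧
    ρ (UK i) (uu k) =
      vv ^ (((if ((k : ZMod m)) = i then 1 else 0) : ℤ) -
        ((if ((k : ZMod m)) = i + 1 then 1 else 0) : ℤ)) • uu k ∧
    ρ (UKinv i) (uu k) =
      vv ^ (-(((if ((k : ZMod m)) = i then 1 else 0) : ℤ) -
        ((if ((k : ZMod m)) = i + 1 then 1 else 0) : ℤ))) • uu k

lemma vv_ne_zero : vv ≠ 0 := RatFunc.X_ne_zero

lemma intCast_mul_add_eq_natCast_iff {q : ℤ} {s t : ℕ} (hs : s < m) (ht : t < m) :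
    ((q * m + s : ℤ) : ZMod m) = (t : ZMod m) ↔ s = t := by
  simp only [Int.cast_add, Int.cast_mul, Int.cast_natCast, CharP.cast_eq_zero, mul_zero, zero_add]
  rw [ZMod.natCast_eq_natCast_iff, Nat.ModEq, Nat.mod_eq_of_lt hs, Nat.mod_eq_of_lt ht]

lemma intCast_mul_add_eq_natCast_add_one_iff {q : ℤ} {s t : ℕ} (hs : s < m) (ht : t < m) :
    ((q * m + s : ℤ) : ZMod m) = (t : ZMod m) + 1 ↔ s = t + 1 ∨ s = 0 ∧ t + 1 = m := by
  rcases (Nat.succ_le_of_lt ht).lt_or_eq with h | h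
  · rw [← Nat.cast_succ, intCast_mul_add_eq_natCast_iff hs h]
    omega
  · rw [← Nat.cast_succ, h, ZMod.natCast_self, ← Nat.cast_zero (R := ZMod m),
      intCast_mul_add_eq_natCast_iff hs (by omega)]
    omega

/-- Every integer is of the form `q m + s` with `0 ≤ s < m`. -/
lemma exists_eq_mul_add_natCast (hm : 0 < m) (k : ℤ) :
    ∃ (q : ℤ) (s : ℕ), s < m ∧ k = q * m + s := by
  have hm' : (0 : ℤ) < m := by exact_mod_cast hm
  refine ⟨k / m, (k % m).toNat, ?_, ?_⟩
  · have := Int.emod_lt_of_pos k hm'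
    have := Int.emod_nonneg k hm'.ne'
    omega
  · rw [Int.toNat_of_nonneg (Int.emod_nonneg k hm'.ne'), mul_comm, Int.mul_ediv_add_emod]

lemma linearMap_ext_uu {f g : Vmod →ₗ[Qv] Vmod} (h : ∀ k, f (uu k) = g (uu k)) : f = g :=
  Finsupp.lhom_ext' fun k => LinearMap.ext_ring (h k)

namespace IsNaturalRep

section

variable {ρ : U m →ₐ[Qv] Module.End Qv Vmod} (h : IsNaturalRep ρ)
include h

lemma E_apply {q : ℤ} {s t : ℕ} (hs : s < m) (ht : t < m) :
    ρ (UE (t : ZMod m)) (uu (q * m + s)) =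
      if s = t + 1 ∨ s = 0 ∧ t + 1 = m then uu (q * m + s - 1) else 0 := by
  simp only [(h _ _).1, intCast_mul_add_eq_natCast_add_one_iff hs ht]

lemma F_apply {q : ℤ} {s t : ℕ} (hs : s < m) (ht : t < m) :
    ρ (UF (t : ZMod m)) (uu (q * m + s)) = if s = t then uu (q * m + s + 1) else 0 := by
  simp only [(h _ _).2.1, intCast_mul_add_eq_natCast_iff hs ht]

lemma K_apply {q : ℤ} {s t : ℕ} (hs : s < m) (ht : t < m) :
    ρ (UK (t : ZMod m)) (uu (q * m + s)) =
      vv ^ ((if s = t then 1 else 0 : ℤ) - (if s = t + 1 ∨ s = 0 ∧ t + 1 = m then 1 else 0 : ℤ)) •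
        uu (q * m + s) := by
  simp only [(h _ _).2.2.1, intCast_mul_add_eq_natCast_iff hs ht,
    intCast_mul_add_eq_natCast_add_one_iff hs ht]

lemma Kinv_apply {q : ℤ} {s t : ℕ} (hs : s < m) (ht : t < m) :
    ρ (UKinv (t : ZMod m)) (uu (q * m + s)) =
      vv ^ (-((if s = t then 1 else 0 : ℤ) -
        (if s = t + 1 ∨ s = 0 ∧ t + 1 = m then 1 else 0 : ℤ))) • uu (q * m + s) := by
  simp only [(h _ _).2.2.2, intCast_mul_add_eq_natCast_iff hs ht,
    intCast_mul_add_eq_natCast_add_one_iff hs ht]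

end

variable {n r : ℕ} {ρ : U (n + 1) →ₐ[Qv] Module.End Qv Vmod} (h : IsNaturalRep ρ)
include h

lemma er_apply (ε : ℤ) {k : ℤ} (hk : (k : ZMod (n + 1)) ≠ r + 1) :
    ρ (er n r ε) (uu k) = if (k : ZMod (n + 1)) = r + 1 + 1 then uu (k - 2) else 0 := by
  have hkk : k - 1 - 1 = k - 2 := by ring
  simp only [er, map_sub, map_mul, map_smul, LinearMap.sub_apply, LinearMap.smul_apply,
    Module.End.mul_apply, (h _ _).1, if_neg hk, map_zero, smul_zero, sub_zero]
  split_ifs with h1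
  · rw [(h _ _).1, if_pos (by push_cast; rw [h1]; ring), hkk]
  · exact map_zero _

lemma fr_apply (ε : ℤ) {k : ℤ} (hk : (k : ZMod (n + 1)) ≠ r + 1) :
    ρ (fr n r ε) (uu k) = if (k : ZMod (n + 1)) = r then uu (k + 2) else 0 := by
  have hkk : k + 1 + 1 = k + 2 := by ring
  simp only [fr, map_sub, map_mul, map_smul, LinearMap.sub_apply, LinearMap.smul_apply,
    Module.End.mul_apply, (h _ _).2.1, if_neg hk, map_zero, smul_zero, sub_zero]
  split_ifs with h1
  · rw [(h _ _).2.1, if_pos (by push_cast; rw [h1]), hkk]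
  · exact map_zero _

lemma kr_apply (k : ℤ) :
    ρ (kr n r) (uu k) = vv ^ ((if (k : ZMod (n + 1)) = r then 1 else 0 : ℤ) -
      (if (k : ZMod (n + 1)) = r + 1 + 1 then 1 else 0 : ℤ)) • uu k := by
  simp only [kr, map_mul, Module.End.mul_apply, (h _ _).2.2.1, map_smul, smul_smul,
    ← zpow_add₀ vv_ne_zero]
  congr 2
  ring

lemma krInv_apply (k : ℤ) :
    ρ (UKinv (r : ZMod (n + 1)) * UKinv ((r : ZMod (n + 1)) + 1)) (uu k) =
      vv ^ (-((if (k : ZMod (n + 1)) = r then 1 else 0 : ℤ) -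
        (if (k : ZMod (n + 1)) = r + 1 + 1 then 1 else 0 : ℤ))) • uu k := by
  simp only [map_mul, Module.End.mul_apply, (h _ _).2.2.2, map_smul, smul_smul,
    ← zpow_add₀ vv_ne_zero]
  congr 2
  ring

end IsNaturalRep

end NaturalRepresentation

section Intertwining

variable {n r : ℕ}

/-- The embedding `V_n → V_{n+1}` skipping the basis vectors with index `r + 1` mod `n + 1`. -/
def IsSkipEmbedding (n r : ℕ) (ι : Vmod →ₗ[Qv] Vmod) : Prop :=
  ∀ (q : ℤ) (s : ℕ), s ≤ n - 1 →
    (s ≤ r → ι (uu (q * n + s)) = uu (q * (n + 1) + s)) ∧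
    (r + 1 ≤ s → ι (uu (q * n + s)) = uu (q * (n + 1) + s + 1))

lemma IsSkipEmbedding.apply {ι : Vmod →ₗ[Qv] Vmod} (hι : IsSkipEmbedding n r ι)
    (q : ℤ) {s : ℕ} (hs : s < n) :
    ι (uu (q * n + s)) = uu (q * (n + 1 : ℕ) + (if s ≤ r then s else s + 1 : ℕ)) := by
  split_ifs with h
  · rw [(hι q s (by omega)).1 h]; push_cast; rfl
  · rw [(hι q s (by omega)).2 (by omega)]; push_cast; rw [add_assoc]

/-- The image under the skipping embedding of the vector preceding `u_{qn+s}`. -/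
lemma IsSkipEmbedding.apply_sub_one {ι : Vmod →ₗ[Qv] Vmod} (hι : IsSkipEmbedding n r ι)
    (hr : r < n) (q : ℤ) {s : ℕ} (hs : s < n) :
    ι (uu (q * n + s - 1)) = uu (q * (n + 1 : ℕ) + (if s ≤ r then s else s + 1 : ℕ) -
      (if s = r + 1 ∨ s = 0 ∧ r + 1 = n then 2 else 1)) := by
  rcases s with _ | s
  · have e : q * (n : ℤ) + (0 : ℕ) - 1 = (q - 1) * n + (n - 1 : ℕ) := by
      push_cast [Nat.cast_sub (show 1 ≤ n by omega)]; ring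
    rw [e, hι.apply _ (by omega)]
    congr 1
    push_cast
    split_ifs <;> grind
  · have e : q * (n : ℤ) + (s + 1 : ℕ) - 1 = q * n + s := by push_cast; ring
    rw [e, hι.apply _ (by omega)]
    congr 1
    split_ifs <;> grind

/-- The image under the skipping embedding of the vector following `u_{qn+s}`. -/
lemma IsSkipEmbedding.apply_add_one {ι : Vmod →ₗ[Qv] Vmod} (hι : IsSkipEmbedding n r ι)
    (hr : r < n) (q : ℤ) {s : ℕ} (hs : s < n) :
    ι (uu (q * n + s + 1)) = uu (q * (n + 1 : ℕ) + (if s ≤ r then s else s + 1 : ℕ) +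
      (if s = r then 2 else 1)) := by
  rcases (Nat.succ_le_of_lt hs).lt_or_eq with h | h
  · have e : q * (n : ℤ) + s + 1 = q * n + (s + 1 : ℕ) := by push_cast; ring
    rw [e, hι.apply _ h]
    congr 1
    split_ifs <;> grind
  · have e : q * (n : ℤ) + s + 1 = (q + 1) * n + (0 : ℕ) := by
      rw [← h]; push_cast; ring
    rw [e, hι.apply _ (by omega)]
    congr 1
    subst h
    split_ifs <;> grind

/-- The index of the image of `u_{qn+s}` is not congruent to `r + 1` modulo `n + 1`. -/
lemma skip_ne (hr : r < n) (q : ℤ) {s : ℕ} (hs : s < n) :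
    ((q * (n + 1 : ℕ) + (if s ≤ r then s else s + 1 : ℕ) : ℤ) : ZMod (n + 1)) ≠ r + 1 := by
  rw [Ne, ← Nat.cast_succ, intCast_mul_add_eq_natCast_iff (by split_ifs <;> omega) (by omega)]
  split_ifs <;> omega

lemma skip_eq_iff (hr : r < n) (q : ℤ) {s : ℕ} (hs : s < n) :
    ((q * (n + 1 : ℕ) + (if s ≤ r then s else s + 1 : ℕ) : ℤ) : ZMod (n + 1)) = r ↔ s = r := by
  rw [intCast_mul_add_eq_natCast_iff (by split_ifs <;> omega) (by omega)]
  split_ifs <;> omega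

/-- The index of the image of `u_{qn+s}` is congruent to `r + 2` modulo `n + 1` exactly when `s` is
congruent to `r + 1` modulo `n`. -/
lemma skip_eq_add_two_iff (hr : r < n) (q : ℤ) {s : ℕ} (hs : s < n) :
    ((q * (n + 1 : ℕ) + (if s ≤ r then s else s + 1 : ℕ) : ℤ) : ZMod (n + 1)) = r + 1 + 1 ↔
      s = r + 1 ∨ s = 0 ∧ r + 1 = n := by
  rw [← Nat.cast_succ,
    intCast_mul_add_eq_natCast_add_one_iff (by split_ifs <;> omega) (by omega)]
  split_ifs <;> omega

variable {ρn : U n →ₐ[Qv] Module.End Qv Vmod} {ρm : U (n + 1) →ₐ[Qv] Module.End Qv Vmod}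
  {ι : Vmod →ₗ[Qv] Vmod}

lemma comp_eElt (hr : r < n) (ε : ℤ) (hρn : IsNaturalRep ρn) (hρm : IsNaturalRep ρm)
    (hι : IsSkipEmbedding n r ι) (i : ZMod n) :
    LinearMap.comp (ρm (eElt n r ε i)) ι = LinearMap.comp ι (ρn (UE i)) := by
  have : NeZero n := ⟨by omega⟩
  obtain ⟨t, ht, rfl⟩ : ∃ t < n, (t : ZMod n) = i := ⟨i.val, i.val_lt, ZMod.natCast_zmod_val i⟩
  refine linearMap_ext_uu fun k => ?_
  obtain ⟨q, s, hs, rfl⟩ := exists_eq_mul_add_natCast (show 0 < n by omega) k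
  have hs' : (if s ≤ r then s else s + 1) < n + 1 := by split_ifs <;> omega
  rw [LinearMap.comp_apply, LinearMap.comp_apply, hι.apply q hs, hρn.E_apply hs ht,
    apply_ite ι, map_zero, hι.apply_sub_one hr q hs, eElt, ZMod.val_natCast_of_lt ht]
  rcases lt_trichotomy t r with h | rfl | h
  · rw [if_pos h, hρm.E_apply hs' (by omega)]
    split_ifs <;> first | rfl | grind
  · rw [if_neg (lt_irrefl _), if_pos rfl, hρm.er_apply ε (skip_ne hr q hs)]
    simp only [skip_eq_add_two_iff hr q hs]
    split_ifs <;> rfl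
  · rw [if_neg (by omega), if_neg (by omega), hρm.E_apply hs' (by omega)]
    split_ifs <;> first | rfl | grind

lemma comp_fElt (hr : r < n) (ε : ℤ) (hρn : IsNaturalRep ρn) (hρm : IsNaturalRep ρm)
    (hι : IsSkipEmbedding n r ι) (i : ZMod n) :
    LinearMap.comp (ρm (fElt n r ε i)) ι = LinearMap.comp ι (ρn (UF i)) := by
  have : NeZero n := ⟨by omega⟩
  obtain ⟨t, ht, rfl⟩ : ∃ t < n, (t : ZMod n) = i := ⟨i.val, i.val_lt, ZMod.natCast_zmod_val i⟩
  refine linearMap_ext_uu fun k => ?_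
  obtain ⟨q, s, hs, rfl⟩ := exists_eq_mul_add_natCast (show 0 < n by omega) k
  have hs' : (if s ≤ r then s else s + 1) < n + 1 := by split_ifs <;> omega
  rw [LinearMap.comp_apply, LinearMap.comp_apply, hι.apply q hs, hρn.F_apply hs ht,
    apply_ite ι, map_zero, hι.apply_add_one hr q hs, fElt, ZMod.val_natCast_of_lt ht]
  rcases lt_trichotomy t r with h | rfl | h
  · rw [if_pos h, hρm.F_apply hs' (by omega)]
    split_ifs <;> first | rfl | grind
  · rw [if_neg (lt_irrefl _), if_pos rfl, hρm.fr_apply ε (skip_ne hr q hs)]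
    simp only [skip_eq_iff hr q hs]
    split_ifs <;> rfl
  · rw [if_neg (by omega), if_neg (by omega), hρm.F_apply hs' (by omega)]
    split_ifs <;> first | rfl | grind

lemma comp_kElt (hr : r < n) (hρn : IsNaturalRep ρn) (hρm : IsNaturalRep ρm)
    (hι : IsSkipEmbedding n r ι) (i : ZMod n) :
    LinearMap.comp (ρm (kElt n r i)) ι = LinearMap.comp ι (ρn (UK i)) := by
  have : NeZero n := ⟨by omega⟩
  obtain ⟨t, ht, rfl⟩ : ∃ t < n, (t : ZMod n) = i := ⟨i.val, i.val_lt, ZMod.natCast_zmod_val i⟩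
  refine linearMap_ext_uu fun k => ?_
  obtain ⟨q, s, hs, rfl⟩ := exists_eq_mul_add_natCast (show 0 < n by omega) k
  have hs' : (if s ≤ r then s else s + 1) < n + 1 := by split_ifs <;> omega
  rw [LinearMap.comp_apply, LinearMap.comp_apply, hρn.K_apply hs ht, map_smul,
    hι.apply q hs, kElt, ZMod.val_natCast_of_lt ht]
  rcases lt_trichotomy t r with h | rfl | h
  · rw [if_pos h, hρm.K_apply hs' (by omega)]
    congr 2
    split_ifs <;> first | rfl | grind
  · rw [if_neg (lt_irrefl _), if_pos rfl, hρm.kr_apply]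
    simp only [skip_eq_iff hr q hs, skip_eq_add_two_iff hr q hs]
  · rw [if_neg (by omega), if_neg (by omega), hρm.K_apply hs' (by omega)]
    congr 2
    split_ifs <;> first | rfl | grind

lemma comp_kinvElt (hr : r < n) (hρn : IsNaturalRep ρn) (hρm : IsNaturalRep ρm)
    (hι : IsSkipEmbedding n r ι) (i : ZMod n) :
    LinearMap.comp (ρm (kinvElt n r i)) ι = LinearMap.comp ι (ρn (UKinv i)) := by
  have : NeZero n := ⟨by omega⟩
  obtain ⟨t, ht, rfl⟩ : ∃ t < n, (t : ZMod n) = i := ⟨i.val, i.val_lt, ZMod.natCast_zmod_val i⟩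
  refine linearMap_ext_uu fun k => ?_
  obtain ⟨q, s, hs, rfl⟩ := exists_eq_mul_add_natCast (show 0 < n by omega) k
  have hs' : (if s ≤ r then s else s + 1) < n + 1 := by split_ifs <;> omega
  rw [LinearMap.comp_apply, LinearMap.comp_apply, hρn.Kinv_apply hs ht, map_smul,
    hι.apply q hs, kinvElt, ZMod.val_natCast_of_lt ht]
  rcases lt_trichotomy t r with h | rfl | h
  · rw [if_pos h, hρm.Kinv_apply hs' (by omega)]
    congr 2
    split_ifs <;> first | rfl | grind
  · rw [if_neg (lt_irrefl _), if_pos rfl, hρm.krInv_apply]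
    simp only [skip_eq_iff hr q hs, skip_eq_add_two_iff hr q hs]
  · rw [if_neg (by omega), if_neg (by omega), hρm.Kinv_apply hs' (by omega)]
    congr 2
    split_ifs <;> first | rfl | grind

end Intertwining

lemma mem_range_of_comp_eq {f g ι : Vmod →ₗ[Qv] Vmod} (h : LinearMap.comp f ι = LinearMap.comp ι g)
    {w : Vmod} (hw : w ∈ LinearMap.range ι) : f w ∈ LinearMap.range ι := by
  obtain ⟨x, rfl⟩ := hw
  exact ⟨g x, (LinearMap.congr_fun h x).symm⟩

/-- A submodule invariant under a generating set of an algebra of operators is invariant. -/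
lemma apply_mem_of_mem_adjoin {A : Type} [Ring A] [Algebra Qv A] (ρ : A →ₐ[Qv] Module.End Qv Vmod)
    {S : Set A} {W : Submodule Qv Vmod} (hS : ∀ x ∈ S, ∀ w ∈ W, ρ x w ∈ W) {x : A}
    (hx : x ∈ Algebra.adjoin Qv S) : ∀ w ∈ W, ρ x w ∈ W := by
  induction hx using Algebra.adjoin_induction with
  | mem x hx => exact hS x hx
  | algebraMap c =>
    intro w hw
    rw [AlgHom.commutes, Module.algebraMap_end_apply]
    exact W.smul_mem c hw
  | add x y _ _ ihx ihy =>
    intro w hw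
    rw [map_add]
    exact W.add_mem (ihx w hw) (ihy w hw)
  | mul x y _ _ ihx ihy =>
    intro w hw
    rw [map_mul]
    exact ihx _ (ihy w hw)

set_option synthInstance.maxHeartbeats 1000000 in
set_option maxHeartbeats 1000000 in
/-- the intertwining identities ρ_{n+1}(e_i) ∘ ι = ι ∘ ρ_n(E_i),
ρ_{n+1}(f_i) ∘ ι = ι ∘ ρ_n(F_i), ρ_{n+1}(k_i^{±1}) ∘ ι = ι ∘ ρ_n(K_i^{±1}); in
particular the image of ι is invariant under the subalgebra generated by the
e_i, f_i, k_i^{±1}. -/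
theorem intertwining_identities
    (n r : ℕ) (hn : 2 ≤ n) (hr : r ≤ n - 1) (ε : ℤ) (hε : ε = 1 ∨ ε = -1)
    (ρn : U n →ₐ[Qv] Module.End Qv Vmod)
    (hρn : ∀ (i : ZMod n) (k : ℤ),
      ρn (UE i) (uu k) = (if ((k : ZMod n)) = i + 1 then uu (k - 1) else 0) ∧
      ρn (UF i) (uu k) = (if ((k : ZMod n)) = i then uu (k + 1) else 0) ∧
      ρn (UK i) (uu k) =
        vv ^ (((if ((k : ZMod n)) = i then 1 else 0) : ℤ) -
          ((if ((k : ZMod n)) = i + 1 then 1 else 0) : ℤ)) • uu k ∧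
      ρn (UKinv i) (uu k) =
        vv ^ (-(((if ((k : ZMod n)) = i then 1 else 0) : ℤ) -
          ((if ((k : ZMod n)) = i + 1 then 1 else 0) : ℤ))) • uu k)
    (ρm : U (n + 1) →ₐ[Qv] Module.End Qv Vmod)
    (hρm : ∀ (i : ZMod (n + 1)) (k : ℤ),
      ρm (UE i) (uu k) = (if ((k : ZMod (n + 1))) = i + 1 then uu (k - 1) else 0) ∧
      ρm (UF i) (uu k) = (if ((k : ZMod (n + 1))) = i then uu (k + 1) else 0) ∧
      ρm (UK i) (uu k) =
        vv ^ (((if ((k : ZMod (n + 1))) = i then 1 else 0) : ℤ) -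
          ((if ((k : ZMod (n + 1))) = i + 1 then 1 else 0) : ℤ)) • uu k ∧
      ρm (UKinv i) (uu k) =
        vv ^ (-(((if ((k : ZMod (n + 1))) = i then 1 else 0) : ℤ) -
          ((if ((k : ZMod (n + 1))) = i + 1 then 1 else 0) : ℤ))) • uu k)
    (ι : Vmod →ₗ[Qv] Vmod)
    (hι : ∀ (q : ℤ) (s : ℕ), s ≤ n - 1 →
      (s ≤ r → ι (uu (q * n + s)) = uu (q * (n + 1) + s)) ∧
      (r + 1 ≤ s → ι (uu (q * n + s)) = uu (q * (n + 1) + s + 1))) :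
    (∀ i : ZMod n,
      LinearMap.comp (ρm (eElt n r ε i)) ι = LinearMap.comp ι (ρn (UE i)) ∧
      LinearMap.comp (ρm (fElt n r ε i)) ι = LinearMap.comp ι (ρn (UF i)) ∧
      LinearMap.comp (ρm (kElt n r i)) ι = LinearMap.comp ι (ρn (UK i)) ∧
      LinearMap.comp (ρm (kinvElt n r i)) ι = LinearMap.comp ι (ρn (UKinv i))) ∧
    (∀ x ∈ Algebra.adjoin Qv
        (Set.range (eElt n r ε) ∪ Set.range (fElt n r ε) ∪
          Set.range (kElt n r) ∪ Set.range (kinvElt n r)),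
      ∀ w ∈ LinearMap.range ι, ρm x w ∈ LinearMap.range ι) := by
  have hrn : r < n := by omega
  have hE := comp_eElt hrn ε hρn hρm hι
  have hF := comp_fElt hrn ε hρn hρm hι
  have hK := comp_kElt hrn hρn hρm hι
  have hKinv := comp_kinvElt hrn hρn hρm hι
  refine ⟨fun i => ⟨hE i, hF i, hK i, hKinv i⟩, fun x hx => apply_mem_of_mem_adjoin ρm ?_ hx⟩
  rintro _ (((⟨i, rfl⟩ | ⟨i, rfl⟩) | ⟨i, rfl⟩) | ⟨i, rfl⟩) w hw
  · exact mem_range_of_comp_eq (hE i) hw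
  · exact mem_range_of_comp_eq (hF i) hw
  · exact mem_range_of_comp_eq (hK i) hw
  · exact mem_range_of_comp_eq (hKinv i) hw

end
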